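/- The e-adjacency tensor allows the retrieval of the cardinalities of the hyperedges: for every j with 1 ≤ j ≤ k - 1, the sum of r(t) over all tuples t : Fin k → Fin N with t(0) = n + j - 1 (the index of the additional vertex y_j) equals |{e ∈ E : |e| ≤ j}|, the number of hyperedges of cardinality at most j. -/

import Mathlib

open Finset

/-- Embedding of the original vertices `Fin n` into the extended vertex set `Fin (n + k - 1)`. -/
def emb (n k : ℕ) (hk : 1 ≤ k) (v : Fin n) : Fin (n + k - 1) :=
  ⟨(v : ℕ), by have := v.isLt; omega⟩

/-- The additional vertex `y_{j+1}` corresponds to the index `n + j` of `Fin (n + k - 1)`. -/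
def addIdx (n k : ℕ) (j : Fin (k - 1)) : Fin (n + k - 1) :=
  ⟨n + (j : ℕ), by have := j.isLt; omega⟩

/-- The set of additional indices `{n+s-1, ..., n+k-2}` used to fill a hyperedge `e`
of cardinality `s`. -/
def addSet (n k : ℕ) (e : Finset (Fin n)) : Finset (Fin (n + k - 1)) :=
  (Finset.univ.filter fun j : Fin (k - 1) => e.card - 1 ≤ (j : ℕ)).image (addIdx n k)

/-- The filled hyperedge `ê ⊆ Fin (n + k - 1)` of a hyperedge `e ⊆ Fin n`. -/
def filled (n k : ℕ) (hk : 1 ≤ k) (e : Finset (Fin n)) : Finset (Fin (n + k - 1)) :=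
  e.image (emb n k hk) ∪ addSet n k e

/-- The e-adjacency tensor of the hypergraph with hyperedge family `E`:
`r t = 1/(k-1)!` if `t` is injective with image a filled hyperedge, and `0` otherwise. -/
noncomputable def eAdj (n k : ℕ) (hk : 1 ≤ k) (E : Finset (Finset (Fin n))) :
    (Fin k → Fin (n + k - 1)) → ℝ := fun t =>
  if Function.Injective t ∧ ∃ e ∈ E, Finset.image t Finset.univ = filled n k hk e then
    1 / (Nat.factorial (k - 1)) else 0

/-- The degree of a vertex `v`: the number of hyperedges containing `v`. -/
def deg (n : ℕ) (E : Finset (Finset (Fin n))) (v : Fin n) : ℕ :=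
  (E.filter fun e => v ∈ e).card

/-- The tuple `(i, t 0, ..., t (m-2)) : Fin m → Fin N`. -/
def extend (m N : ℕ) (i : Fin N) (t : Fin (m - 1) → Fin N) : Fin m → Fin N :=
  fun j => if h : (j : ℕ) = 0 then i else t ⟨(j : ℕ) - 1, by have := j.isLt; omega⟩

/-- `(lam, x)` is an eigenpair of the order-`m`, dimension-`N` hypermatrix `T`. -/
def IsEigenpair (m N : ℕ) (T : (Fin m → Fin N) → ℝ) (lam : ℂ) (x : Fin N → ℂ) : Prop :=
  x ≠ 0 ∧ ∀ i : Fin N,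
    ∑ t : Fin (m - 1) → Fin N, (T (extend m N i t) : ℂ) * ∏ j : Fin (m - 1), x (t j)
      = lam * x i ^ (m - 1)


theorem emb_injective (n k : ℕ) (hk : 1 ≤ k) : Function.Injective (emb n k hk) := by
  intro a b h
  simpa [emb, Fin.ext_iff] using h

theorem addIdx_injective (n k : ℕ) : Function.Injective (addIdx n k) := by
  intro a b h
  simpa [addIdx, Fin.ext_iff] using h

theorem emb_notMem_addSet (n k : ℕ) (hk : 1 ≤ k) (e : Finset (Fin n)) (v : Fin n) :
    emb n k hk v ∉ addSet n k e := by
  simp only [addSet, emb, addIdx, mem_image, not_exists, not_and, Fin.ext_iff]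
  intro j _ h
  have := v.isLt
  omega

theorem emb_mem_filled (n k : ℕ) (hk : 1 ≤ k) (e : Finset (Fin n)) (v : Fin n) :
    emb n k hk v ∈ filled n k hk e ↔ v ∈ e := by
  rw [filled, mem_union, or_iff_left (emb_notMem_addSet n k hk e v),
    (emb_injective n k hk).mem_finset_image]

theorem filled_injective (n k : ℕ) (hk : 1 ≤ k) : Function.Injective (filled n k hk) := by
  intro e f h
  ext v
  rw [← emb_mem_filled n k hk e, h, emb_mem_filled]

theorem addIdx_mem_filled (n k : ℕ) (hk : 1 ≤ k) (e : Finset (Fin n)) (j : Fin (k - 1)) :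
    addIdx n k j ∈ filled n k hk e ↔ e.card - 1 ≤ (j : ℕ) := by
  have hne : addIdx n k j ∉ e.image (emb n k hk) := by
    simp only [emb, addIdx, mem_image, not_exists, not_and, Fin.ext_iff]
    intro v _ h
    have := v.isLt
    omega
  rw [filled, mem_union, or_iff_right hne, addSet, (addIdx_injective n k).mem_finset_image]
  simp

theorem card_addSet (n k : ℕ) (e : Finset (Fin n)) :
    (addSet n k e).card = k - 1 - (e.card - 1) := by
  rw [addSet, card_image_of_injective _ (addIdx_injective n k),
    ← Nat.card_Ico (e.card - 1) (k - 1), ← card_map Fin.valEmbedding]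
  refine congrArg card ?_
  ext x
  simp only [mem_map, mem_filter, mem_univ, true_and, Fin.valEmbedding_apply, mem_Ico]
  exact ⟨by rintro ⟨a, h, rfl⟩; exact ⟨h, a.isLt⟩, fun h => ⟨⟨x, h.2⟩, h.1, rfl⟩⟩

theorem card_filled (n k : ℕ) (hk : 1 ≤ k) (e : Finset (Fin n)) (he : e.Nonempty)
    (hek : e.card ≤ k) : (filled n k hk e).card = k := by
  have hd : Disjoint (e.image (emb n k hk)) (addSet n k e) := by
    rw [disjoint_left]
    intro x hx
    obtain ⟨v, -, rfl⟩ := mem_image.1 hx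
    exact emb_notMem_addSet n k hk e v
  rw [filled, card_union_of_disjoint hd, card_image_of_injective _ (emb_injective n k hk),
    card_addSet]
  have := he.card_pos
  omega

/-- The number of orderings of a set of `m + 1` elements with a prescribed first element. -/
theorem card_orderings_with_head {α : Type*} [Fintype α] [DecidableEq α] (m : ℕ)
    (S : Finset α) (hS : S.card = m + 1) (a : α) (ha : a ∈ S)
    [DecidablePred fun t : Fin (m + 1) → α =>
      t 0 = a ∧ Function.Injective t ∧ univ.image t = S] :
    (univ.filter fun t : Fin (m + 1) → α =>
      t 0 = a ∧ Function.Injective t ∧ univ.image t = S).card = m.factorial := by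
  have hcard : Fintype.card (Fin m ↪ ↥(S.erase a)) = m.factorial := by
    rw [Fintype.card_embedding_eq, Fintype.card_coe, card_erase_of_mem ha, hS, Fintype.card_fin,
      Nat.add_sub_cancel, Nat.descFactorial_self]
  rw [← hcard, ← card_univ]
  symm
  refine card_bij (fun f _ => (Fin.cons a fun i => (f i : α) : Fin (m + 1) → α)) ?_ ?_ ?_
  · intro f _
    have hinj : Function.Injective (Fin.cons a fun i => (f i : α) : Fin (m + 1) → α) := by
      rw [Fin.cons_injective_iff]
      refine ⟨?_, Subtype.val_injective.comp f.injective⟩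
      rintro ⟨i, hi⟩
      exact (mem_erase.1 (f i).2).1 hi
    refine mem_filter.2 ⟨mem_univ _, Fin.cons_zero _ _, hinj, ?_⟩
    refine eq_of_subset_of_card_le ?_ ?_
    · intro x hx
      obtain ⟨i, -, rfl⟩ := mem_image.1 hx
      refine Fin.cases ?_ (fun i => ?_) i
      · simpa using ha
      · simpa using (mem_erase.1 (f i).2).2
    · rw [card_image_of_injective _ hinj, hS, card_univ, Fintype.card_fin]
  · intro f _ g _ h
    ext i
    simpa using congrFun h i.succ
  · intro t ht
    obtain ⟨-, h0, hinj, him⟩ := mem_filter.1 ht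
    refine ⟨⟨fun i => ⟨t i.succ, mem_erase.2 ⟨?_, ?_⟩⟩, ?_⟩, mem_univ _, ?_⟩
    · rw [← h0]
      exact hinj.ne (Fin.succ_ne_zero i)
    · rw [← him]
      exact mem_image_of_mem _ (mem_univ _)
    · intro i j h
      exact Fin.succ_injective _ (hinj (congrArg Subtype.val h))
    · funext i
      refine Fin.cases ?_ (fun i => ?_) i
      · simpa using h0.symm
      · rfl

open Classical in
/-- The e-adjacency tensor is the sum of the contributions of the individual hyperedges. -/
theorem eAdj_eq_sum (n k : ℕ) (hk : 1 ≤ k) (E : Finset (Finset (Fin n)))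
    (t : Fin k → Fin (n + k - 1)) :
    eAdj n k hk E t = ∑ e ∈ E, if Function.Injective t ∧ univ.image t = filled n k hk e then
      (1 : ℝ) / (k - 1).factorial else 0 := by
  rw [eAdj]
  split_ifs with h
  · obtain ⟨hinj, e, he, hte⟩ := h
    rw [sum_eq_single_of_mem e he, if_pos ⟨hinj, hte⟩]
    intro f _ hfe
    exact if_neg fun hf => hfe (filled_injective n k hk (hf.2.symm.trans hte))
  · exact (sum_eq_zero fun e he => if_neg fun hf => h ⟨hf.1, e, he, hf.2⟩).symm

/-- Retrieval of hyperedge cardinalities from the e-adjacency tensor: for `1 ≤ j ≤ k - 1`,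
the sum of the entries `r t` over all tuples `t` whose first component is the additional
vertex `y_j` (index `n + j - 1`) equals the number of hyperedges of cardinality at most `j`. -/
theorem eAdj_cardinality_retrieval (n k : ℕ) (hn : 1 ≤ n) (hk : 2 ≤ k)
    (E : Finset (Finset (Fin n)))
    (hE1 : ∀ e ∈ E, e.Nonempty) (hE2 : ∀ e ∈ E, e.card ≤ k)
    (j : ℕ) (hj1 : 1 ≤ j) (hj2 : j ≤ k - 1) :
    ∑ t ∈ Finset.univ.filter
        (fun t : Fin k → Fin (n + k - 1) => t ⟨0, by omega⟩ = ⟨n + j - 1, by omega⟩),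
      eAdj n k (by omega) E t = ((E.filter fun e => e.card ≤ j).card : ℝ) := by
  classical
  obtain ⟨m, rfl⟩ : ∃ m, k = m + 1 := ⟨k - 1, by omega⟩
  have hidx : (⟨n + j - 1, by omega⟩ : Fin (n + (m + 1) - 1)) =
      addIdx n (m + 1) ⟨j - 1, by omega⟩ := by
    simp only [addIdx, Fin.mk.injEq]
    omega
  simp_rw [eAdj_eq_sum, hidx]
  rw [sum_comm, card_filter, Nat.cast_sum]
  refine sum_congr rfl fun e he => ?_
  have hpos := (hE1 e he).card_pos
  have hmem := addIdx_mem_filled n (m + 1) (by omega) e ⟨j - 1, by omega⟩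
  rw [← sum_filter, filter_filter, sum_const, nsmul_eq_mul]
  split_ifs with hej
  · have hcount := card_orderings_with_head m (filled n (m + 1) (by omega) e)
      (card_filled n (m + 1) (by omega) e (hE1 e he) (hE2 e he)) _
      (hmem.2 (Nat.sub_le_sub_right hej 1))
    rw [Fin.zero_eta, hcount, Nat.add_sub_cancel, Nat.cast_one,
      mul_one_div_cancel (Nat.cast_ne_zero.2 m.factorial_ne_zero)]
  · rw [filter_eq_empty_iff.2, card_empty, Nat.cast_zero, zero_mul]
    rintro t - ⟨h0, -, him⟩
    have hle : e.card - 1 ≤ j - 1 := by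
      rw [← hmem, ← him, ← h0]
      exact mem_image_of_mem _ (mem_univ _)
    omega
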